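/- arXiv:2507.00384 — 3 statements merged into one kernel-verified Lean document; each statement's English description precedes it below -/
import Mathlib

section
/- Let L be a finite-dimensional Lie algebra over ℂ with radical R and Killing radical K, let S be a Levi subalgebra of L, and let Z_s ⊆ R be a subspace with ⁅S, Z_s⁆ ⊆ Z_s and R = Z_s ⊕ K (internal direct sum). Set L_s := S + Z_s (a direct sum of subspaces). Then L_s is closed under the Lie bracket if and only if ⁅Z_s, Z_s⁆ = 0; and in that case, the derived algebra of the Lie subalgebra L_s equals S and the centre of L_s equals Z_s. -/
/-- The Killing radical of a Lie algebra over ℂ: the kernel of the Killing form,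
`K = {x ∈ L | κ(x,y) = 0 for all y ∈ L}`. -/
def killingRad (L : Type*) [LieRing L] [LieAlgebra ℂ L] : Submodule ℂ L where
  carrier := {x : L | ∀ y : L, killingForm ℂ L x y = 0}
  add_mem' := by
    intro a b ha hb y
    rw [map_add, LinearMap.add_apply, ha y, hb y, add_zero]
  zero_mem' := by
    intro y
    rw [map_zero, LinearMap.zero_apply]
  smul_mem' := by
    intro c a ha y
    rw [map_smul, LinearMap.smul_apply, ha y, smul_zero]

namespace LieModule

variable {k L : Type*} [Field k] [CharZero k] [IsAlgClosed k] [LieRing L] [LieAlgebra k L]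

/-- If `A` is a solvable ideal, a nontrivial finite-dimensional module contains a nonzero submodule
annihilated by `⁅L, A⁆`. -/
theorem exists_ne_bot_forall_lie_lie_eq_zero (A : LieIdeal k L) [LieAlgebra.IsSolvable A]
    (M : Type*) [AddCommGroup M] [Module k M] [LieRingModule L M] [LieModule k L M]
    [FiniteDimensional k M] [Nontrivial M] :
    ∃ N : LieSubmodule k L M, N ≠ ⊥ ∧ ∀ x : L, ∀ a ∈ A, ∀ m ∈ N, ⁅⁅x, a⁆, m⁆ = 0 := by
  obtain ⟨χ, hχ⟩ := exists_nontrivial_weightSpace_of_isSolvable k A M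
  let N : LieSubmodule k L M := weightSpaceOfIsLieTower k M χ
  have mem_N {m : M} : m ∈ N ↔ ∀ b : A, ⁅b, m⁆ = χ b • m := mem_weightSpace χ m
  refine ⟨N, fun hN ↦ ?_, fun x a ha m hm ↦ ?_⟩
  · obtain ⟨m, hm⟩ := exists_ne (0 : weightSpace M χ)
    have : (m : M) ∈ N := m.2
    rw [hN, LieSubmodule.mem_bot] at this
    exact hm (Subtype.ext this)
  · have h₁ : ⁅a, m⁆ = χ ⟨a, ha⟩ • m := mem_N.mp hm ⟨a, ha⟩
    have h₂ : ⁅a, ⁅x, m⁆⁆ = χ ⟨a, ha⟩ • ⁅x, m⁆ := mem_N.mp (N.lie_mem hm) ⟨a, ha⟩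
    rw [lie_lie, h₁, h₂, lie_smul, sub_self]

/-- If `A` is a solvable ideal, `⁅x, a⁆ y` acts nilpotently on every finite-dimensional module,
for all `a ∈ A`. -/
theorem isNilpotent_toEnd_lie_mul_toEnd (A : LieIdeal k L) [LieAlgebra.IsSolvable A]
    (M : Type*) [AddCommGroup M] [Module k M] [LieRingModule L M] [LieModule k L M]
    [FiniteDimensional k M] (x y : L) {a : L} (ha : a ∈ A) :
    _root_.IsNilpotent (toEnd k L M ⁅x, a⁆ * toEnd k L M y) := by
  induction h : Module.finrank k M using Nat.strong_induction_on generalizing M with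
  | _ n ih =>
    cases subsingleton_or_nontrivial M with
    | inl _ => exact ⟨1, Subsingleton.elim _ _⟩
    | inr _ =>
      obtain ⟨N, hN, hNA⟩ := exists_ne_bot_forall_lie_lie_eq_zero A M
      have hlt : Module.finrank k (M ⧸ N) < n := by
        rw [← h]
        have hpos : 0 < Module.finrank k N.toSubmodule :=
          Nat.pos_of_ne_zero (by simpa [Submodule.finrank_eq_zero] using hN)
        have hadd := N.toSubmodule.finrank_quotient_add_finrank
        change Module.finrank k (M ⧸ N.toSubmodule) < _
        lia
      obtain ⟨j, hj⟩ := ih _ hlt (M ⧸ N) rfl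
      have hmk (i : ℕ) (m : M) :
          LieSubmodule.Quotient.mk (N := N) (((toEnd k L M ⁅x, a⁆ * toEnd k L M y) ^ i) m) =
            ((toEnd k L (M ⧸ N) ⁅x, a⁆ * toEnd k L (M ⧸ N) y) ^ i)
              (LieSubmodule.Quotient.mk m) := by
        induction i with
        | zero => rfl
        | succ i hi =>
          rw [pow_succ', pow_succ', Module.End.mul_apply, Module.End.mul_apply _ (_ ^ i), ← hi]
          rfl
      refine ⟨j + 1, LinearMap.ext fun m ↦ ?_⟩
      have hm : ((toEnd k L M ⁅x, a⁆ * toEnd k L M y) ^ j) m ∈ N := by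
        refine LieSubmodule.Quotient.mk_eq_zero'.mp ((hmk j m).trans ?_)
        rw [hj, LinearMap.zero_apply]
      rw [pow_succ', Module.End.mul_apply]
      exact hNA x a ha _ (N.lie_mem hm)

/-- If `A` is a solvable ideal, `⁅L, A⁆` is contained in the kernel of every trace form. -/
theorem traceForm_lie_apply_eq_zero_of_isSolvable (A : LieIdeal k L) [LieAlgebra.IsSolvable A]
    (M : Type*) [AddCommGroup M] [Module k M] [LieRingModule L M] [LieModule k L M]
    [FiniteDimensional k M] (x y : L) {a : L} (ha : a ∈ A) :
    traceForm k L M ⁅x, a⁆ y = 0 :=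
  (LinearMap.isNilpotent_trace_of_isNilpotent
    (isNilpotent_toEnd_lie_mul_toEnd A M x y ha)).eq_zero

end LieModule

namespace LieAlgebra

/-- A Lie algebra with nondegenerate Killing form is perfect. -/
theorem IsKilling.lie_top_top_eq_top (k L : Type*) [Field k] [LieRing L] [LieAlgebra k L]
    [FiniteDimensional k L] [IsKilling k L] :
    ⁅(⊤ : LieIdeal k L), (⊤ : LieIdeal k L)⁆ = ⊤ := by
  set I : LieIdeal k L := ⁅(⊤ : LieIdeal k L), (⊤ : LieIdeal k L)⁆
  have hcompl := I.isCompl_killingCompl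
  have hle : I.killingCompl ≤ center k L := by
    intro z hz
    rw [LieModule.mem_maxTrivSubmodule]
    intro x
    have h₁ : ⁅x, z⁆ ∈ I := LieSubmodule.lie_mem_lie trivial trivial
    have h₂ : ⁅x, z⁆ ∈ I.killingCompl := I.killingCompl.lie_mem hz
    simpa [hcompl.inf_eq_bot] using (LieSubmodule.mem_inf _ _ _).mpr ⟨h₁, h₂⟩
  rw [center_eq_bot, le_bot_iff] at hle
  simpa [hle] using hcompl.sup_eq_top

end LieAlgebra

/-- `⁅L, R⁆` lies in the Killing radical, where `R` is the solvable radical of `L`. -/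
theorem lie_mem_killingRad {L : Type*} [LieRing L] [LieAlgebra ℂ L] [FiniteDimensional ℂ L]
    (x : L) {r : L} (hr : r ∈ LieAlgebra.radical ℂ L) : ⁅x, r⁆ ∈ killingRad L := fun y ↦
  LieModule.traceForm_lie_apply_eq_zero_of_isSolvable (LieAlgebra.radical ℂ L) L x y hr

/-- With `L_s := S + Z_s`: `L_s` is closed under the Lie bracket iff `⁅Z_s, Z_s⁆ = 0`;
and in that case the derived algebra of `L_s` equals `S` and the centre of `L_s` equals
`Z_s`. -/
theorem statement4 (L : Type*) [LieRing L] [LieAlgebra ℂ L] [FiniteDimensional ℂ L]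
    (S : LieSubalgebra ℂ L) (hS : LieAlgebra.IsSemisimple ℂ S)
    (hLevi : IsCompl S.toSubmodule (LieAlgebra.radical ℂ L).toSubmodule)
    (Zs : Submodule ℂ L)
    (hZsR : Zs ≤ (LieAlgebra.radical ℂ L).toSubmodule)
    (hSZs : ∀ s ∈ S, ∀ z ∈ Zs, ⁅s, z⁆ ∈ Zs)
    (hdisj : Disjoint Zs (killingRad L))
    (hsum : Zs ⊔ killingRad L = (LieAlgebra.radical ℂ L).toSubmodule) :
    ((∀ x ∈ S.toSubmodule ⊔ Zs, ∀ y ∈ S.toSubmodule ⊔ Zs, ⁅x, y⁆ ∈ S.toSubmodule ⊔ Zs) ↔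
      (∀ z ∈ Zs, ∀ z' ∈ Zs, ⁅z, z'⁆ = (0 : L))) ∧
    ((∀ z ∈ Zs, ∀ z' ∈ Zs, ⁅z, z'⁆ = (0 : L)) →
      Submodule.span ℂ
          {w : L | ∃ x ∈ S.toSubmodule ⊔ Zs, ∃ y ∈ S.toSubmodule ⊔ Zs, w = ⁅x, y⁆}
        = S.toSubmodule ∧
      {w : L | w ∈ S.toSubmodule ⊔ Zs ∧ ∀ x ∈ S.toSubmodule ⊔ Zs, ⁅w, x⁆ = 0}
        = (Zs : Set L)) := by
  have hKR : killingRad L ≤ (LieAlgebra.radical ℂ L).toSubmodule := hsum ▸ le_sup_right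
  have hSZ : ∀ s ∈ S, ∀ z ∈ Zs, ⁅s, z⁆ = (0 : L) := fun s hs z hz ↦
    Submodule.disjoint_def.mp hdisj _ (hSZs s hs z hz) (lie_mem_killingRad s (hZsR hz))
  have hlie (hZ : ∀ z ∈ Zs, ∀ z' ∈ Zs, ⁅z, z'⁆ = (0 : L)) {s z s' z' : L} (hs : s ∈ S)
      (hz : z ∈ Zs) (hs' : s' ∈ S) (hz' : z' ∈ Zs) : ⁅s + z, s' + z'⁆ = ⁅s, s'⁆ := by
    rw [add_lie, lie_add, lie_add, hSZ s hs z' hz', hZ z hz z' hz', ← lie_skew z s',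
      hSZ s' hs' z hz]
    simp
  refine ⟨⟨fun hclosed z hz z' hz' ↦ ?_, fun hZ x hx y hy ↦ ?_⟩, fun hZ ↦ ⟨?_, ?_⟩⟩
  · have hK : ⁅z, z'⁆ ∈ killingRad L := lie_mem_killingRad z (hZsR hz')
    obtain ⟨s, hs, w, hw, hsw⟩ := Submodule.mem_sup.mp
      (hclosed z (Submodule.mem_sup_right hz) z' (Submodule.mem_sup_right hz'))
    have hsR : s ∈ (LieAlgebra.radical ℂ L).toSubmodule := by
      rw [eq_sub_of_add_eq hsw]
      exact sub_mem (hKR hK) (hZsR hw)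
    have hs0 : s = 0 := Submodule.disjoint_def.mp hLevi.disjoint s hs hsR
    rw [hs0, zero_add] at hsw
    exact Submodule.disjoint_def.mp hdisj _ (hsw ▸ hw) hK
  · obtain ⟨s, hs, z, hz, rfl⟩ := Submodule.mem_sup.mp hx
    obtain ⟨s', hs', z', hz', rfl⟩ := Submodule.mem_sup.mp hy
    rw [hlie hZ hs hz hs' hz']
    exact Submodule.mem_sup_left (S.lie_mem hs hs')
  · refine le_antisymm (Submodule.span_le.mpr ?_) fun s hs ↦ ?_
    · rintro _ ⟨x, hx, y, hy, rfl⟩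
      obtain ⟨s, hs, z, hz, rfl⟩ := Submodule.mem_sup.mp hx
      obtain ⟨s', hs', z', hz', rfl⟩ := Submodule.mem_sup.mp hy
      rw [hlie hZ hs hz hs' hz']
      exact S.lie_mem hs hs'
    · have hmem : (⟨s, hs⟩ : S) ∈ (⁅(⊤ : LieIdeal ℂ S), (⊤ : LieIdeal ℂ S)⁆).toSubmodule := by
        rw [LieAlgebra.IsKilling.lie_top_top_eq_top]
        trivial
      rw [LieSubmodule.lieIdeal_oper_eq_linear_span'] at hmem
      refine Submodule.span_mono ?_
        (Submodule.map_span S.toSubmodule.subtype _ ▸ Submodule.mem_map_of_mem hmem)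
      rintro _ ⟨_, ⟨x, -, y, -, rfl⟩, rfl⟩
      exact ⟨x, Submodule.mem_sup_left x.2, y, Submodule.mem_sup_left y.2, rfl⟩
  · ext w
    constructor
    · rintro ⟨hw, hcomm⟩
      obtain ⟨s, hs, z, hz, rfl⟩ := Submodule.mem_sup.mp hw
      have hcenter : (⟨s, hs⟩ : S) ∈ LieAlgebra.center ℂ S := by
        rw [LieModule.mem_maxTrivSubmodule]
        intro t
        have h0 := hcomm t (Submodule.mem_sup_left t.2)
        rw [← add_zero (t : L), hlie hZ hs hz t.2 Zs.zero_mem] at h0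
        apply Subtype.ext
        change ⁅(t : L), s⁆ = 0
        rw [← lie_skew, h0, neg_zero]
      rw [LieAlgebra.center_eq_bot, LieSubmodule.mem_bot] at hcenter
      have hs0 : s = 0 := congrArg Subtype.val hcenter
      rwa [hs0, zero_add]
    · refine fun hw ↦ ⟨Submodule.mem_sup_right hw, fun x hx ↦ ?_⟩
      obtain ⟨s, hs, z, hz, rfl⟩ := Submodule.mem_sup.mp hx
      rw [← zero_add w, hlie hZ S.zero_mem hw hs hz, zero_lie]
end

section
/- Let L be a finite-dimensional Lie algebra over ℂ with radical R and Killing radical K, let S be a Levi subalgebra of L, and let Z_s ⊆ R be a subspace with ⁅S, Z_s⁆ ⊆ Z_s and R = Z_s ⊕ K (internal direct sum). Let C_L(S) := {x ∈ L | ⁅x, s⁆ = 0 for all s ∈ S} and let ⁅S,K⁆ denote the subspace spanned by all brackets ⁅s,y⁆ with s ∈ S, y ∈ K. Then: (i) Z_s ⊆ C_L(S) ⊆ R; (ii) C_L(S) = Z_s ⊕ (C_L(S) ∩ K) (internal direct sum); (iii) R = Z_s ⊕ (C_L(S) ∩ K) ⊕ ⁅S,K⁆ (internal direct sum). -/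
/-- The centraliser of a subset `s` of a Lie algebra, as a subspace:
`{x ∈ L | ⁅x, a⁆ = 0 for all a ∈ s}`. -/
def centralizerSub {L : Type*} [LieRing L] [LieAlgebra ℂ L] (s : Set L) : Submodule ℂ L where
  carrier := {x : L | ∀ a ∈ s, ⁅x, a⁆ = 0}
  add_mem' := by
    intro u v hu hv a ha
    rw [add_lie, hu a ha, hv a ha, add_zero]
  zero_mem' := by
    intro a ha
    rw [zero_lie]
  smul_mem' := by
    intro c u hu a ha
    rw [smul_lie, hu a ha, smul_zero]

/-- The subspace spanned by all brackets `⁅a, b⁆` with `a ∈ A`, `b ∈ B`. -/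
def bracketSpan {L : Type*} [LieRing L] [LieAlgebra ℂ L] (A B : Set L) : Submodule ℂ L :=
  Submodule.span ℂ {x : L | ∃ a ∈ A, ∃ b ∈ B, x = ⁅a, b⁆}

open LieModule LieAlgebra Module

section
attribute [local instance] LieRing.ofAssociativeRing

variable {k L M : Type*} [Field k] [CharZero k] [LieRing L] [LieAlgebra k L]
  [AddCommGroup M] [Module k M] [LieRingModule L M] [LieModule k L M]

/-- On a nonzero module, the brackets with the radical have a nonzero common kernel. -/
lemma LieAlgebra.exists_nontrivial_lieSubmodule_lie_radical_eq_zero [IsAlgClosed k]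
    [FiniteDimensional k L] [FiniteDimensional k M] [Nontrivial M] :
    ∃ N : LieSubmodule k L M, Nontrivial N ∧
      ∀ x : L, ∀ r ∈ radical k L, ∀ n ∈ N, ⁅⁅x, r⁆, n⁆ = 0 := by
  obtain ⟨χ, hχ⟩ : ∃ χ : Module.Dual k (radical k L), Nontrivial (weightSpace M χ) :=
    exists_nontrivial_weightSpace_of_isSolvable k (radical k L) M
  let N : LieSubmodule k L M := weightSpaceOfIsLieTower k M χ
  have hN : Nontrivial N := hχ
  refine ⟨N, hN, fun x r hr n hn ↦ ?_⟩
  have hmem (r : L) (hr : r ∈ radical k L) (n : M) (hn : n ∈ N) : ⁅r, n⁆ = χ ⟨r, hr⟩ • n :=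
    (mem_weightSpace (R := k) (L := radical k L) (M := M) χ n).mp hn ⟨r, hr⟩
  have hxr : ⁅x, r⁆ ∈ radical k L := (radical k L).lie_mem hr
  have hend : toEnd k L N ⁅x, r⁆ = χ ⟨_, hxr⟩ • LinearMap.id := by
    ext m
    simpa using hmem _ hxr m m.2
  have htr : LinearMap.trace k N (toEnd k L N ⁅x, r⁆) = 0 := by simp
  rw [hend, map_smul, LinearMap.trace_id, smul_eq_mul, mul_eq_zero] at htr
  have : (finrank k N : k) ≠ 0 := by exact_mod_cast finrank_pos.ne'
  rw [hmem _ hxr n hn, htr.resolve_right this, zero_smul]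

/-- Products `⁅x, r⁆ y` with `r` in the radical act nilpotently on finite-dimensional modules. -/
lemma LieAlgebra.isNilpotent_toEnd_lie_radical_mul [IsAlgClosed k]
    [FiniteDimensional k L] [FiniteDimensional k M] (x r y : L) (hr : r ∈ radical k L) :
    _root_.IsNilpotent (toEnd k L M ⁅x, r⁆ * toEnd k L M y) := by
  induction hn : finrank k M using Nat.strong_induction_on generalizing M with
  | _ n ih =>
    rcases subsingleton_or_nontrivial M with hM | hM
    · exact ⟨1, LinearMap.ext fun m ↦ Subsingleton.elim _ _⟩
    obtain ⟨N, hN, hzero⟩ :=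
      exists_nontrivial_lieSubmodule_lie_radical_eq_zero (k := k) (L := L) (M := M)
    have hlt : finrank k (M ⧸ N) < n := by
      have h₁ := Submodule.finrank_quotient_add_finrank N.toSubmodule
      have h₂ : 0 < finrank k N := finrank_pos
      have h₃ : finrank k (M ⧸ N) = finrank k (M ⧸ N.toSubmodule) := rfl
      have h₄ : finrank k N = finrank k N.toSubmodule := rfl
      omega
    obtain ⟨p, hp⟩ := ih _ hlt (M := M ⧸ N) rfl
    have hmk (q : ℕ) (m : M) :
        (LieSubmodule.Quotient.mk (((toEnd k L M ⁅x, r⁆ * toEnd k L M y) ^ q) m) : M ⧸ N) =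
        ((toEnd k L (M ⧸ N) ⁅x, r⁆ * toEnd k L (M ⧸ N) y) ^ q) (LieSubmodule.Quotient.mk m) := by
      induction q with
      | zero => rfl
      | succ q ihq =>
        rw [pow_succ', pow_succ', Module.End.mul_apply, Module.End.mul_apply _ (_ ^ q), ← ihq]
        rfl
    refine ⟨p + 1, LinearMap.ext fun m ↦ ?_⟩
    have hmem : ((toEnd k L M ⁅x, r⁆ * toEnd k L M y) ^ p) m ∈ N := by
      rw [← LieSubmodule.Quotient.mk_eq_zero', hmk, hp, LinearMap.zero_apply]
    rw [pow_succ', Module.End.mul_apply]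
    exact hzero x r hr _ (N.lie_mem hmem)

lemma LieAlgebra.killingForm_lie_radical_eq_zero [IsAlgClosed k] [FiniteDimensional k L]
    (x r y : L) (hr : r ∈ radical k L) : killingForm k L ⁅x, r⁆ y = 0 :=
  (LinearMap.isNilpotent_trace_of_isNilpotent
    (isNilpotent_toEnd_lie_radical_mul (M := L) x r y hr)).eq_zero

/-- A Lie algebra with a faithful module whose trace form vanishes is solvable. -/
lemma LieAlgebra.isSolvable_of_isFaithful_of_traceForm_eq_zero [FiniteDimensional k L]
    [FiniteDimensional k M] [IsFaithful k L M] (h : traceForm k L M = 0) : IsSolvable L := by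
  have hnil := (isNilpotent_iff_forall' (R := k)).mp
    (isNilpotent_derivedSeries_of_traceForm_eq_zero h)
  have : LieRing.IsNilpotent (derivedSeries k L 1) := by
    rw [LieAlgebra.isNilpotent_iff_forall (R := k)]
    intro x
    obtain ⟨n, hn⟩ := LieAlgebra.ad_nilpotent_of_nilpotent (R := k) (hnil x)
    have hmap (q : ℕ) (y : derivedSeries k L 1) :
        toEnd k L M (((ad k (derivedSeries k L 1) x) ^ q) y : derivedSeries k L 1) =
        ((ad k (Module.End k M) (toEnd k L M x)) ^ q) (toEnd k L M y) := by
      induction q with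
      | zero => rfl
      | succ q ihq =>
        rw [pow_succ', pow_succ', Module.End.mul_apply, Module.End.mul_apply, ← ihq]
        exact LieHom.map_lie (toEnd k L M) _ _
    refine ⟨n, LinearMap.ext fun y ↦ Subtype.ext ?_⟩
    rw [LinearMap.zero_apply, ZeroMemClass.coe_zero, ← toEnd_eq_zero_iff k L M, hmap]
    exact LinearMap.congr_fun hn _
  obtain ⟨n, hn⟩ := IsSolvable.solvable k (derivedSeries k L 1)
  rw [LieIdeal.derivedSeries_eq_bot_iff] at hn
  exact IsSolvable.mk (R := k) (k := n + 1) (by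
    rw [derivedSeries_def, derivedSeriesOfIdeal_add]
    exact hn)

variable (k L M) in
/-- A semisimple Lie algebra acting nontrivially has a Casimir operator of nonzero trace. -/
lemma LieAlgebra.exists_casimir [FiniteDimensional k L] [FiniteDimensional k M]
    [HasTrivialRadical k L] (hM : ¬ IsTrivial L M) :
    ∃ (n : ℕ) (a b : Fin n → L),
      (∀ x, Commute (∑ i, toEnd k L M (a i) * toEnd k L M (b i)) (toEnd k L M x)) ∧
      LinearMap.trace k M (∑ i, toEnd k L M (a i) * toEnd k L M (b i)) ≠ 0 := by
  let A : LieIdeal k L := LieModule.ker k L M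
  let J : LieIdeal k L := A.killingCompl
  have hAJ : IsCompl A J := A.isCompl_killingCompl
  have hA (x : L) : x ∈ A ↔ toEnd k L M x = 0 := by
    rw [LieModule.mem_ker, LinearMap.ext_iff]
    rfl
  have hdecomp (x : L) : ∃ y ∈ J, toEnd k L M x = toEnd k L M y := by
    obtain ⟨a, ha, y, hy, rfl⟩ := (LieSubmodule.mem_sup A J x).mp
      (hAJ.sup_eq_top ▸ LieSubmodule.mem_top x)
    exact ⟨y, hy, by rw [map_add, (hA a).mp ha, zero_add]⟩
  let B : LinearMap.BilinForm k J := traceForm k J M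
  have hBsymm : B.IsSymm := ⟨traceForm_comm k J M⟩
  have hker : InvariantForm.orthogonal (traceForm k L M) (traceForm_lieInvariant k L M) ⊤ ⊓ J
      = ⊥ := by
    set I := InvariantForm.orthogonal (traceForm k L M) (traceForm_lieInvariant k L M) ⊤ ⊓ J
    have : IsFaithful k I M := by
      rw [isFaithful_iff']
      rintro ⟨x, hx⟩ hx0
      have hxA : x ∈ A := (hA x).mpr (LinearMap.ext hx0)
      exact Subtype.ext (by simpa using hAJ.disjoint.le_bot ⟨hxA, hx.2⟩)
    have htf : traceForm k I M = 0 := by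
      ext ⟨x, hx⟩ ⟨y, hy⟩
      exact (InvariantForm.mem_orthogonal _ _ _ _).mp hy.1 x (LieSubmodule.mem_top x)
    have := isSolvable_of_isFaithful_of_traceForm_eq_zero htf
    exact HasTrivialRadical.eq_bot_of_isSolvable I
  have hB : B.Nondegenerate := by
    refine hBsymm.isRefl.nondegenerate_iff_separatingRight.mpr fun y hy ↦ ?_
    have : (y : L) ∈ (⊥ : LieIdeal k L) := by
      rw [← hker]
      refine ⟨(InvariantForm.mem_orthogonal _ _ _ _).mpr fun x _ ↦ ?_, y.2⟩
      obtain ⟨z, hz, hxz⟩ := hdecomp x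
      rw [traceForm_apply_apply, hxz]
      exact hy ⟨z, hz⟩
    exact Subtype.ext (by simpa using this)
  let b := finBasis k J
  let d := B.dualBasis hB b
  refine ⟨finrank k J, fun i ↦ d i, fun i ↦ b i, fun x ↦ ?_, ?_⟩
  · have hd (i) : ⁅x, d i⁆ = ∑ j, B ⁅x, d i⁆ (b j) • d j := by
      conv_lhs => rw [← d.sum_repr ⁅x, d i⁆]
      simp [d]
    have hb (i) : ⁅x, b i⁆ = ∑ j, B ⁅x, b i⁆ (d j) • b j := by
      have hdd := B.dualBasis_dualBasis hB hBsymm b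
      conv_lhs => rw [← b.sum_repr ⁅x, b i⁆]
      refine Finset.sum_congr rfl fun j _ ↦ ?_
      rw [← B.dualBasis_repr_apply hB d, hdd]
    have hinv (i j) : B ⁅x, d i⁆ (b j) = - B ⁅x, b j⁆ (d i) := by
      rw [hBsymm.eq ⁅x, b j⁆]
      exact traceForm_lieInvariant k L M x (d i) (b j)
    have hlie (y : L) : toEnd k L M x * toEnd k L M y =
        toEnd k L M y * toEnd k L M x + toEnd k L M ⁅x, y⁆ := by
      ext m
      simp
    have hsum : ∑ i, toEnd k L M (d i) * toEnd k L M ⁅x, (b i : L)⁆ +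
        ∑ i, toEnd k L M ⁅x, (d i : L)⁆ * toEnd k L M (b i) = 0 := by
      have hd' (i) : toEnd k L M ⁅x, (d i : L)⁆ =
          ∑ j, B ⁅x, d i⁆ (b j) • toEnd k L M (d j) := by
        simpa using congr_arg (fun y : J ↦ toEnd k L M y) (hd i)
      have hb' (i) : toEnd k L M ⁅x, (b i : L)⁆ =
          ∑ j, B ⁅x, b i⁆ (d j) • toEnd k L M (b j) := by
        simpa using congr_arg (fun y : J ↦ toEnd k L M y) (hb i)
      simp_rw [hd', hb', hinv, Finset.mul_sum, Finset.sum_mul, mul_smul_comm, smul_mul_assoc]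
      rw [Finset.sum_comm (γ := Fin (finrank k J)), ← Finset.sum_add_distrib]
      refine Finset.sum_eq_zero fun i _ ↦ ?_
      rw [← Finset.sum_add_distrib]
      refine Finset.sum_eq_zero fun j _ ↦ ?_
      rw [neg_smul, add_neg_cancel]
    refine Commute.symm ?_
    rw [commute_iff_eq, Finset.mul_sum, Finset.sum_mul, ← sub_eq_zero, ← hsum,
      ← Finset.sum_sub_distrib, ← Finset.sum_add_distrib]
    refine Finset.sum_congr rfl fun i _ ↦ ?_
    rw [← mul_assoc, hlie, add_mul, mul_assoc, hlie, mul_add, mul_assoc]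
    abel
  · have hJ : finrank k J ≠ 0 := by
      intro h0
      have := finrank_zero_iff.mp h0
      refine hM ⟨fun x m ↦ ?_⟩
      obtain ⟨y, hy, hxy⟩ := hdecomp x
      have hy0 : y = 0 := congr_arg Subtype.val (Subsingleton.elim (⟨y, hy⟩ : J) 0)
      rw [← toEnd_apply_apply k, hxy, hy0, map_zero, LinearMap.zero_apply]
    rw [map_sum, Finset.sum_congr rfl (g := fun _ ↦ (1 : k))]
    · simpa using hJ
    · intro i _
      exact (B.apply_dualBasis_left hB b i i).trans (if_pos rfl)

/-- For a semisimple Lie algebra, a finite-dimensional module is the direct sum of its invariants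
and of the submodule spanned by the brackets. -/
theorem LieModule.isCompl_maxTrivSubmodule_lie_top [FiniteDimensional k L]
    [FiniteDimensional k M] [HasTrivialRadical k L] :
    IsCompl (maxTrivSubmodule k L M) ⁅(⊤ : LieIdeal k L), (⊤ : LieSubmodule k L M)⁆ := by
  induction hn : finrank k M using Nat.strong_induction_on generalizing M with
  | _ n ih =>
    by_cases hM : IsTrivial L M
    · rw [(isTrivial_iff_max_triv_eq_top k L M).mp hM, LieSubmodule.trivial_lie_oper_zero]
      exact isCompl_top_bot
    obtain ⟨l, a, b, hcomm, htr⟩ := exists_casimir k L M hM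
    set c := ∑ i, toEnd k L M (a i) * toEnd k L M (b i) with hc
    have hc_mem (m : M) : c m ∈ ⁅(⊤ : LieIdeal k L), (⊤ : LieSubmodule k L M)⁆ := by
      rw [hc, LinearMap.sum_apply]
      exact sum_mem fun i _ ↦
        LieSubmodule.lie_mem_lie (LieSubmodule.mem_top _) (LieSubmodule.mem_top _)
    have hc_zero (m : M) (hm : m ∈ maxTrivSubmodule k L M) : c m = 0 := by
      rw [hc, LinearMap.sum_apply]
      refine Finset.sum_eq_zero fun i _ ↦ ?_
      rw [Module.End.mul_apply, toEnd_apply_apply k L M (b i), hm, map_zero]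
    obtain ⟨q, hq, hcompl⟩ : ∃ q, 1 ≤ q ∧
        IsCompl (LinearMap.ker (c ^ q)) (LinearMap.range (c ^ q)) :=
      ((Filter.eventually_ge_atTop 1).and c.eventually_isCompl_ker_pow_range_pow).exists
    have hcomm_apply (x : L) (m : M) : (c ^ q) ⁅x, m⁆ = ⁅x, (c ^ q) m⁆ :=
      LinearMap.congr_fun ((hcomm x).pow_left q).eq m
    let N₀ : LieSubmodule k L M :=
      { LinearMap.ker (c ^ q) with
        lie_mem {x m} hm := by
          change (c ^ q) ⁅x, m⁆ = 0
          rw [hcomm_apply, show (c ^ q) m = 0 from hm, lie_zero] }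
    let N₁ : LieSubmodule k L M :=
      { LinearMap.range (c ^ q) with
        lie_mem {x m} hm := by
          obtain ⟨m', rfl⟩ := hm
          exact ⟨⁅x, m'⁆, hcomm_apply x m'⟩ }
    replace hcompl : IsCompl N₀ N₁ := (LieSubmodule.isCompl_toSubmodule).mp hcompl
    have hmemN₀ (m : M) : m ∈ N₀ ↔ (c ^ q) m = 0 := Iff.rfl
    have hlt : finrank k N₀ < n := by
      rw [← hn]
      refine Submodule.finrank_lt (s := N₀.toSubmodule) fun htop ↦ htr ?_
      have hnil : _root_.IsNilpotent c := ⟨q, LinearMap.ext fun m ↦ (hmemN₀ m).mp <| by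
        rw [← LieSubmodule.mem_toSubmodule, htop]; trivial⟩
      exact (LinearMap.isNilpotent_trace_of_isNilpotent hnil).eq_zero
    have hN₀ := ih _ hlt (M := N₀) rfl
    have hmap : ⁅(⊤ : LieIdeal k L), (⊤ : LieSubmodule k L N₀)⁆.map N₀.incl =
        ⁅(⊤ : LieIdeal k L), N₀⁆ := by
      rw [LieSubmodule.map_bracket_eq]
      simp
    have hN₁ : N₁ ≤ ⁅(⊤ : LieIdeal k L), (⊤ : LieSubmodule k L M)⁆ := by
      rintro - ⟨m, rfl⟩
      obtain ⟨p, rfl⟩ := Nat.exists_eq_add_of_le hq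
      rw [pow_add, pow_one]
      exact hc_mem _
    constructor
    · rw [disjoint_iff, LieSubmodule.eq_bot_iff]
      rintro u ⟨hu, hu'⟩
      have huN₀ : u ∈ N₀ := by
        obtain ⟨p, rfl⟩ := Nat.exists_eq_add_of_le' hq
        rw [hmemN₀, pow_succ, Module.End.mul_apply, hc_zero u hu, map_zero]
      rw [← hcompl.sup_eq_top, LieSubmodule.lie_sup] at hu'
      obtain ⟨u₀, hu₀, u₁, hu₁, rfl⟩ := (LieSubmodule.mem_sup _ _ _).mp hu'
      have hu₁' : u₁ = 0 := by
        have h₀ : u₁ ∈ N₀ := by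
          simpa using sub_mem huN₀ (LieSubmodule.lie_le_right N₀ ⊤ hu₀)
        simpa using hcompl.disjoint.le_bot ⟨h₀, LieSubmodule.lie_le_right N₁ ⊤ hu₁⟩
      subst hu₁'
      rw [← hmap] at hu₀
      obtain ⟨v, hv, rfl⟩ := hu₀
      rw [add_zero] at hu
      have : v ∈ maxTrivSubmodule k L N₀ := fun x ↦ Subtype.ext (hu x)
      have hv0 : v = 0 := by simpa using hN₀.disjoint.le_bot ⟨this, hv⟩
      simp [hv0]
    · rw [codisjoint_iff_le_sup]
      refine hcompl.sup_eq_top.ge.trans <| sup_le (fun m hm ↦ ?_) (hN₁.trans le_sup_right)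
      obtain ⟨u, hu, v, hv, huv⟩ := (LieSubmodule.mem_sup _ _ _).mp
        (hN₀.sup_eq_top ▸ LieSubmodule.mem_top (⟨m, hm⟩ : N₀))
      refine (LieSubmodule.mem_sup _ _ _).mpr ⟨u, fun x ↦ congr_arg Subtype.val (hu x), v, ?_,
        congr_arg Subtype.val huv⟩
      exact LieSubmodule.mono_lie_right ⊤ le_top (hmap ▸ LieSubmodule.mem_map_of_mem hv)

end

section
variable {L : Type*} [LieRing L] [LieAlgebra ℂ L]

lemma mem_killingRad_iff {x : L} :
    x ∈ killingRad L ↔ x ∈ LieIdeal.killingCompl ℂ L (⊤ : LieIdeal ℂ L) := by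
  rw [LieIdeal.mem_killingCompl]
  exact ⟨fun h y _ ↦ (traceForm_comm ℂ L L y x).trans (h y),
    fun h y ↦ (traceForm_comm ℂ L L x y).trans (h y (LieSubmodule.mem_top y))⟩

lemma mem_centralizerSub_iff {S : LieSubalgebra ℂ L} {x : L} :
    x ∈ centralizerSub (S : Set L) ↔ ∀ s ∈ S, ⁅s, x⁆ = 0 :=
  forall₂_congr fun s _ ↦ by rw [← lie_skew, neg_eq_zero]

/-- A semisimple subalgebra splits the Killing radical into invariants and brackets. -/
lemma centralizerSub_inf_killingRad_split [FiniteDimensional ℂ L] (S : LieSubalgebra ℂ L)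
    [HasTrivialRadical ℂ S] :
    Disjoint (centralizerSub (S : Set L) ⊓ killingRad L)
        (bracketSpan (S : Set L) (killingRad L : Set L)) ∧
      (centralizerSub (S : Set L) ⊓ killingRad L) ⊔
        bracketSpan (S : Set L) (killingRad L : Set L) = killingRad L := by
  let K : LieIdeal ℂ L := LieIdeal.killingCompl ℂ L ⊤
  have hcompl := isCompl_maxTrivSubmodule_lie_top (k := ℂ) (L := S) (M := K)
  rw [← LieSubmodule.isCompl_toSubmodule] at hcompl
  have hK : K.toSubmodule = killingRad L := Submodule.ext fun x ↦ mem_killingRad_iff.symm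
  have hinj : Function.Injective K.toSubmodule.subtype := Subtype.val_injective
  have hinv : (maxTrivSubmodule ℂ S K).toSubmodule.map K.toSubmodule.subtype =
      centralizerSub (S : Set L) ⊓ killingRad L := by
    ext x
    rw [Submodule.mem_inf, mem_centralizerSub_iff, mem_killingRad_iff]
    constructor
    · rintro ⟨y, hy, rfl⟩
      exact ⟨fun s hs ↦ congr_arg Subtype.val (hy ⟨s, hs⟩), y.2⟩
    · rintro ⟨hx, hxK⟩
      exact ⟨⟨x, hxK⟩, fun s ↦ Subtype.ext (hx s s.2), rfl⟩
  have hbr : (⁅(⊤ : LieIdeal ℂ S), (⊤ : LieSubmodule ℂ S K)⁆).toSubmodule.map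
      K.toSubmodule.subtype = bracketSpan (S : Set L) (killingRad L : Set L) := by
    rw [LieSubmodule.lieIdeal_oper_eq_linear_span', Submodule.map_span, bracketSpan]
    congr 1
    ext x
    constructor
    · rintro ⟨-, ⟨s, -, y, -, rfl⟩, rfl⟩
      exact ⟨s, s.2, y, mem_killingRad_iff.mpr y.2, rfl⟩
    · rintro ⟨s, hs, y, hy, rfl⟩
      exact ⟨_, ⟨⟨s, hs⟩, LieSubmodule.mem_top _, ⟨y, mem_killingRad_iff.mp hy⟩,
        LieSubmodule.mem_top _, rfl⟩, rfl⟩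
  rw [← hinv, ← hbr]
  refine ⟨Submodule.disjoint_map hinj hcompl.disjoint, ?_⟩
  rw [← Submodule.map_sup, hcompl.sup_eq_top, Submodule.map_top, Submodule.range_subtype, hK]

/-- The centraliser of a Levi subalgebra lies in the radical. -/
lemma centralizerSub_le_radical (S : LieSubalgebra ℂ L) [HasTrivialRadical ℂ S]
    (hLevi : IsCompl S.toSubmodule (radical ℂ L).toSubmodule) :
    centralizerSub (S : Set L) ≤ (radical ℂ L).toSubmodule := by
  intro x hx
  obtain ⟨s, hs, r, hr, rfl⟩ := Submodule.mem_sup.mp (hLevi.sup_eq_top ▸ Submodule.mem_top (x := x))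
  have hcomm (t : L) (ht : t ∈ S) : ⁅t, s⁆ = 0 := by
    have h := mem_centralizerSub_iff.mp hx t ht
    rw [lie_add, add_eq_zero_iff_eq_neg] at h
    have hR : ⁅t, s⁆ ∈ (radical ℂ L).toSubmodule :=
      h ▸ neg_mem ((radical ℂ L).lie_mem hr)
    exact (Submodule.disjoint_def.mp hLevi.disjoint) _ (S.lie_mem ht hs) hR
  have hs0 : (⟨s, hs⟩ : S) ∈ center ℂ S := fun t ↦ Subtype.ext (hcomm t t.2)
  rw [center_eq_bot, LieSubmodule.mem_bot] at hs0
  rw [show s = 0 from congr_arg Subtype.val hs0, zero_add]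
  exact hr

end

/-- With `R = Z_s ⊕ K` an `S`-stable decomposition of the radical, and `C_L(S)` the
centraliser of the Levi subalgebra `S`:
(i) `Z_s ⊆ C_L(S) ⊆ R`;
(ii) `C_L(S) = Z_s ⊕ (C_L(S) ∩ K)`;
(iii) `R = Z_s ⊕ (C_L(S) ∩ K) ⊕ ⁅S, K⁆` (internal direct sums). -/
theorem statement6 (L : Type*) [LieRing L] [LieAlgebra ℂ L] [FiniteDimensional ℂ L]
    (S : LieSubalgebra ℂ L) (hS : LieAlgebra.IsSemisimple ℂ S)
    (hLevi : IsCompl S.toSubmodule (LieAlgebra.radical ℂ L).toSubmodule)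
    (Zs : Submodule ℂ L)
    (hZsR : Zs ≤ (LieAlgebra.radical ℂ L).toSubmodule)
    (hSZs : ∀ s ∈ S, ∀ z ∈ Zs, ⁅s, z⁆ ∈ Zs)
    (hdisj : Disjoint Zs (killingRad L))
    (hsum : Zs ⊔ killingRad L = (LieAlgebra.radical ℂ L).toSubmodule) :
    (Zs ≤ centralizerSub (S : Set L) ∧
      centralizerSub (S : Set L) ≤ (LieAlgebra.radical ℂ L).toSubmodule) ∧
    (centralizerSub (S : Set L) = Zs ⊔ (centralizerSub (S : Set L) ⊓ killingRad L) ∧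
      Disjoint Zs (centralizerSub (S : Set L) ⊓ killingRad L)) ∧
    ((LieAlgebra.radical ℂ L).toSubmodule
        = Zs ⊔ (centralizerSub (S : Set L) ⊓ killingRad L)
          ⊔ bracketSpan (S : Set L) (killingRad L : Set L) ∧
      Disjoint Zs ((centralizerSub (S : Set L) ⊓ killingRad L)
          ⊔ bracketSpan (S : Set L) (killingRad L : Set L)) ∧
      Disjoint (centralizerSub (S : Set L) ⊓ killingRad L)
          (Zs ⊔ bracketSpan (S : Set L) (killingRad L : Set L)) ∧
      Disjoint (bracketSpan (S : Set L) (killingRad L : Set L))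
          (Zs ⊔ (centralizerSub (S : Set L) ⊓ killingRad L))) := by
  have hZC : Zs ≤ centralizerSub (S : Set L) := fun z hz ↦
    mem_centralizerSub_iff.mpr fun s hs ↦ Submodule.disjoint_def.mp hdisj _ (hSZs s hs z hz)
      fun y ↦ killingForm_lie_radical_eq_zero s z y (hZsR hz)
  have hCR := centralizerSub_le_radical S hLevi
  obtain ⟨hdisjK, hsumK⟩ := centralizerSub_inf_killingRad_split S
  have hdisjZ : Disjoint Zs ((centralizerSub (S : Set L) ⊓ killingRad L)
      ⊔ bracketSpan (S : Set L) (killingRad L : Set L)) := hsumK.symm ▸ hdisj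
  refine ⟨⟨hZC, hCR⟩, ⟨?_, hdisj.mono_right inf_le_right⟩, ?_, hdisjZ, ?_, ?_⟩
  · rw [inf_comm, ← sup_inf_assoc_of_le _ hZC, hsum, inf_eq_right.mpr hCR]
  · rw [sup_assoc, hsumK, hsum]
  · rw [sup_comm]
    exact hdisjK.disjoint_sup_right_of_disjoint_sup_left hdisjZ.symm
  · rw [sup_comm]
    exact hdisjK.symm.disjoint_sup_right_of_disjoint_sup_left (by rwa [sup_comm, disjoint_comm])
end

section
/- Let L be a finite-dimensional Lie algebra over ℂ with radical R and Killing radical K, equipped with a ℤ-grading (L_i)_{i∈ℤ} admitting a level operator d ∈ L (so ⁅d,x⁆ = i·x for all x ∈ L_i and all i). Then for every i ≠ 0, R ∩ L_i = K ∩ L_i. -/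
open LieModule in
/-- If `I` is a solvable ideal of a Lie algebra `L`, then on every finite-dimensional
representation of `L` each product `⁅l, r⁆ y` with `r ∈ I` acts nilpotently. -/
theorem LieIdeal.isNilpotent_toEnd_lie_comp_toEnd {k L : Type*} [Field k] [CharZero k]
    [IsAlgClosed k] [LieRing L] [LieAlgebra k L] (I : LieIdeal k L) [LieAlgebra.IsSolvable I]
    (V : Type*) [AddCommGroup V] [Module k V] [FiniteDimensional k V]
    [LieRingModule L V] [LieModule k L V] (l y : L) {r : L} (hr : r ∈ I) :
    _root_.IsNilpotent (toEnd k L V ⁅l, r⁆ ∘ₗ toEnd k L V y) := by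
  obtain hV | hV := subsingleton_or_nontrivial V
  · exact ⟨1, Subsingleton.elim _ _⟩
  obtain ⟨χ, hχ⟩ := exists_nontrivial_weightSpace_of_isSolvable k I V
  let W : LieSubmodule k L V := weightSpaceOfIsLieTower k V χ
  have mem_W (v : V) : v ∈ W ↔ ∀ a : I, ⁅a, v⁆ = χ a • v := mem_weightSpace χ v
  have lie_W (v : V) (hv : v ∈ W) : ⁅⁅l, r⁆, v⁆ = 0 := by
    have h₁ : ⁅r, v⁆ = χ ⟨r, hr⟩ • v := (mem_W v).1 hv ⟨r, hr⟩
    have h₂ : ⁅r, ⁅l, v⁆⁆ = χ ⟨r, hr⟩ • ⁅l, v⁆ := (mem_W _).1 (W.lie_mem hv) ⟨r, hr⟩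
    rw [lie_lie, h₁, h₂, lie_smul, sub_self]
  obtain ⟨n, hn⟩ := isNilpotent_toEnd_lie_comp_toEnd I (V ⧸ W) l y hr
  set f := toEnd k L V ⁅l, r⁆ ∘ₗ toEnd k L V y
  have mk_pow (m : ℕ) (v : V) :
      LieSubmodule.Quotient.mk' W ((f ^ m) v) =
        ((toEnd k L (V ⧸ W) ⁅l, r⁆ ∘ₗ toEnd k L (V ⧸ W) y) ^ m)
          (LieSubmodule.Quotient.mk' W v) := by
    induction m with
    | zero => simp
    | succ m ih =>
      rw [pow_succ', pow_succ', Module.End.mul_apply, Module.End.mul_apply, ← ih]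
      simp only [f, LinearMap.comp_apply, toEnd_apply_apply, LieModuleHom.map_lie]
  refine ⟨n + 1, LinearMap.ext fun v ↦ ?_⟩
  have hv : (f ^ n) v ∈ W := by
    rw [← LieSubmodule.Quotient.mk_eq_zero, mk_pow, hn, LinearMap.zero_apply]
  rw [pow_succ', Module.End.mul_apply]
  exact lie_W _ (W.lie_mem hv)
termination_by Module.finrank k V
decreasing_by
  have hW : W.toSubmodule ≠ ⊥ := by
    obtain ⟨⟨v, hv⟩, hv0⟩ := exists_ne (0 : weightSpace V χ)
    exact fun h ↦ hv0 (Subtype.ext ((Submodule.eq_bot_iff _).1 h v hv))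
  have hadd := W.toSubmodule.finrank_quotient_add_finrank
  have hpos := Submodule.one_le_finrank_iff.2 hW
  exact lt_of_lt_of_le (Nat.lt_add_of_pos_right hpos) hadd.le

/-- The Killing form of `L` vanishes on `⁅L, I⁆ × L` for every solvable ideal `I`. -/
theorem LieIdeal.killingForm_lie_eq_zero {k L : Type*} [Field k] [CharZero k]
    [IsAlgClosed k] [LieRing L] [LieAlgebra k L] [FiniteDimensional k L]
    (I : LieIdeal k L) [LieAlgebra.IsSolvable I] (l y : L) {r : L} (hr : r ∈ I) :
    killingForm k L ⁅l, r⁆ y = 0 := by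
  rw [killingForm_apply_apply]
  exact (LinearMap.isNilpotent_trace_of_isNilpotent
    (I.isNilpotent_toEnd_lie_comp_toEnd L l y hr)).eq_zero

theorem killingRad_le_radical (L : Type*) [LieRing L] [LieAlgebra ℂ L] [FiniteDimensional ℂ L] :
    killingRad L ≤ (LieAlgebra.radical ℂ L).toSubmodule := fun x hx ↦ by
  refine LieAlgebra.killingCompl_top_le_radical ℂ L ((LieIdeal.mem_killingCompl ℂ L ⊤).2 ?_)
  intro y _
  rw [LieModule.traceForm_comm]
  exact hx y

/-- For a ℤ-graded finite-dimensional complex Lie algebra with level operator `d`,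
the radical and the Killing radical agree in each nonzero degree:
`R ∩ L_i = K ∩ L_i` for `i ≠ 0`. -/
theorem statement8 (L : Type*) [LieRing L] [LieAlgebra ℂ L] [FiniteDimensional ℂ L]
    (Lg : ℤ → Submodule ℂ L)
    (hfin : {i : ℤ | Lg i ≠ ⊥}.Finite)
    (hdecomp : DirectSum.IsInternal Lg)
    (hbracket : ∀ i j : ℤ, ∀ x ∈ Lg i, ∀ y ∈ Lg j, ⁅x, y⁆ ∈ Lg (i + j))
    (d : L) (hd : ∀ i : ℤ, ∀ x ∈ Lg i, ⁅d, x⁆ = (i : ℂ) • x) :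
    ∀ i : ℤ, i ≠ 0 →
      (LieAlgebra.radical ℂ L).toSubmodule ⊓ Lg i = killingRad L ⊓ Lg i := by
  intro i hi
  refine le_antisymm (fun x ⟨hxR, hxi⟩ ↦ ⟨fun y ↦ ?_, hxi⟩)
    (inf_le_inf_right _ (killingRad_le_radical L))
  have h := (LieAlgebra.radical ℂ L).killingForm_lie_eq_zero d y hxR
  rw [hd i x hxi, map_smul, LinearMap.smul_apply, smul_eq_mul] at h
  exact (mul_eq_zero.1 h).resolve_left (Int.cast_ne_zero.2 hi)
end
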